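/- Let u ∈ h¹_ℝ, the real harmonic Hardy space of the unit disc, and 0 ≤ r < 1. Then (1/2π)∫₀^{2π}|u(re^{iθ}) - u(0)| dθ ≤ ‖u‖_{h¹}·(2 - (4/π)arccos r), where ‖u‖_{h¹} = sup_{0≤s<1} (1/2π)∫₀^{2π}|u(se^{iθ})| dθ. -/

import Mathlib

open MeasureTheory Metric

/-- The Poisson kernel minus one. -/
noncomputable def pK (ρ θ : ℝ) : ℝ := (1 - ρ ^ 2) / (1 - 2 * ρ * Real.cos θ + ρ ^ 2) - 1

lemma pK_den_pos {ρ : ℝ} (h0 : 0 ≤ ρ) (h1 : ρ < 1) (θ : ℝ) :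
    0 < 1 - 2 * ρ * Real.cos θ + ρ ^ 2 := by
  nlinarith [Real.cos_le_one θ, mul_nonneg h0 (sub_nonneg.2 (Real.cos_le_one θ)),
    mul_pos (sub_pos.2 h1) (sub_pos.2 h1)]

lemma pK_cont {ρ : ℝ} (h0 : 0 ≤ ρ) (h1 : ρ < 1) : Continuous (pK ρ) := by
  unfold pK
  refine Continuous.sub (Continuous.div (by fun_prop) (by fun_prop) ?_) (by fun_prop)
  intro θ
  exact (pK_den_pos h0 h1 θ).ne'

lemma pK_periodic (ρ : ℝ) : Function.Periodic (pK ρ) (2 * Real.pi) := by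
  intro θ
  simp [pK, Real.cos_add_two_pi]

lemma pK_eq {ρ : ℝ} (h0 : 0 ≤ ρ) (h1 : ρ < 1) (θ : ℝ) :
    pK ρ θ = 2 * ρ * (Real.cos θ - ρ) / (1 - 2 * ρ * Real.cos θ + ρ ^ 2) := by
  have := (pK_den_pos h0 h1 θ).ne'
  unfold pK
  rw [eq_div_iff this, sub_mul, div_mul_cancel₀ _ this]
  ring

/-- Antiderivative of `pK`. -/
noncomputable def pF (ρ θ : ℝ) : ℝ :=
  2 * Real.arctan (ρ * Real.sin θ / (1 - ρ * Real.cos θ))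

lemma pF_deriv {ρ : ℝ} (h0 : 0 ≤ ρ) (h1 : ρ < 1) (θ : ℝ) :
    HasDerivAt (pF ρ) (pK ρ θ) θ := by
  have hd : 0 < 1 - ρ * Real.cos θ := by
    nlinarith [Real.cos_le_one θ, mul_nonneg h0 (sub_nonneg.2 (Real.cos_le_one θ))]
  have h := ((((Real.hasDerivAt_sin θ).const_mul ρ).div
    (((Real.hasDerivAt_cos θ).const_mul ρ).const_sub 1) hd.ne').arctan).const_mul 2
  refine HasDerivAt.congr_deriv (f := pF ρ) h ?_
  rw [pK_eq h0 h1]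
  have h2 := (pK_den_pos h0 h1 θ).ne'
  have hs : Real.sin θ ^ 2 = 1 - Real.cos θ ^ 2 := by
    rw [← Real.sin_sq_add_cos_sq θ]; ring
  have h3 : 1 + (ρ * Real.sin θ / (1 - ρ * Real.cos θ)) ^ 2
      = (1 - 2 * ρ * Real.cos θ + ρ ^ 2) / (1 - ρ * Real.cos θ) ^ 2 := by
    field_simp
    rw [hs]; ring
  simp only [Pi.div_apply]
  rw [h3]
  have hd' := hd.ne'
  field_simp
  linear_combination (-(ρ ^ 2)) * hs

lemma pF_arccos {ρ : ℝ} (h0 : 0 ≤ ρ) (h1 : ρ < 1) :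
    pF ρ (Real.arccos ρ) = 2 * (Real.pi / 2 - Real.arccos ρ) := by
  have : Real.pi / 2 - Real.arccos ρ = Real.arcsin ρ := by rw [Real.arccos]; ring
  rw [this, Real.arcsin_eq_arctan ⟨by linarith, h1⟩, pF, Real.sin_arccos,
    Real.cos_arccos (by linarith) h1.le]
  congr 2
  have hp : 0 < 1 - ρ ^ 2 := by nlinarith
  have hs := Real.sq_sqrt hp.le
  have hs0 := Real.sqrt_pos.2 hp
  have : (1 - ρ * ρ) = √(1 - ρ ^ 2) ^ 2 := by rw [hs]; ring
  rw [this]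
  field_simp

lemma pK_int_sub {ρ : ℝ} (h0 : 0 ≤ ρ) (h1 : ρ < 1) (a b : ℝ) :
    ∫ θ in a..b, pK ρ θ = pF ρ b - pF ρ a :=
  intervalIntegral.integral_eq_sub_of_hasDerivAt (fun x _ => pF_deriv h0 h1 x)
    ((pK_cont h0 h1).intervalIntegrable _ _)

lemma pK_abs_int {ρ : ℝ} (h0 : 0 ≤ ρ) (h1 : ρ < 1) :
    ∫ θ in (0:ℝ)..(2 * Real.pi), |pK ρ θ| =
      2 * Real.pi * (2 - (4 / Real.pi) * Real.arccos ρ) := by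
  set t := Real.arccos ρ with ht
  have ht0 : 0 ≤ t := Real.arccos_nonneg ρ
  have htpi : t ≤ Real.pi / 2 := Real.arccos_le_pi_div_two.2 h0
  have hpi := Real.pi_pos
  have hcos : Real.cos t = ρ := Real.cos_arccos (by linarith) h1.le
  have hc := (pK_cont h0 h1).abs
  have hpos : ∀ θ, ρ ≤ Real.cos θ → |pK ρ θ| = pK ρ θ := by
    intro θ h
    rw [abs_of_nonneg]
    rw [pK_eq h0 h1]
    exact div_nonneg (mul_nonneg (by linarith) (by linarith)) (pK_den_pos h0 h1 θ).le
  have hneg : ∀ θ, Real.cos θ ≤ ρ → |pK ρ θ| = - pK ρ θ := by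
    intro θ h
    rw [abs_of_nonpos]
    rw [pK_eq h0 h1]
    exact div_nonpos_of_nonpos_of_nonneg
      (mul_nonpos_of_nonneg_of_nonpos (by linarith) (by linarith)) (pK_den_pos h0 h1 θ).le
  have i1 : ∫ θ in (0:ℝ)..t, |pK ρ θ| = ∫ θ in (0:ℝ)..t, pK ρ θ := by
    apply intervalIntegral.integral_congr
    intro θ hθ
    rw [Set.uIcc_of_le ht0] at hθ
    apply hpos
    rw [← hcos]
    exact Real.cos_le_cos_of_nonneg_of_le_pi hθ.1 (by linarith) hθ.2
  have i2 : ∫ θ in t..(2 * Real.pi - t), |pK ρ θ| = ∫ θ in t..(2 * Real.pi - t), - pK ρ θ := by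
    apply intervalIntegral.integral_congr
    intro θ hθ
    rw [Set.uIcc_of_le (by linarith)] at hθ
    apply hneg
    rw [← hcos]
    rcases le_total θ Real.pi with h | h
    · exact Real.cos_le_cos_of_nonneg_of_le_pi ht0 h hθ.1
    · rw [← Real.cos_two_pi_sub θ]
      exact Real.cos_le_cos_of_nonneg_of_le_pi ht0 (by linarith) (by linarith [hθ.2])
  have i3 : ∫ θ in (2 * Real.pi - t)..(2 * Real.pi), |pK ρ θ|
      = ∫ θ in (2 * Real.pi - t)..(2 * Real.pi), pK ρ θ := by
    apply intervalIntegral.integral_congr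
    intro θ hθ
    rw [Set.uIcc_of_le (by linarith)] at hθ
    apply hpos
    rw [← hcos, ← Real.cos_two_pi_sub θ]
    exact Real.cos_le_cos_of_nonneg_of_le_pi (by linarith [hθ.2]) (by linarith)
      (by linarith [hθ.1])
  rw [← intervalIntegral.integral_add_adjacent_intervals (b := 2 * Real.pi - t)
    (hc.intervalIntegrable _ _) (hc.intervalIntegrable _ _),
    ← intervalIntegral.integral_add_adjacent_intervals (b := t)
    (hc.intervalIntegrable _ _) (hc.intervalIntegrable _ _), i1, i2, i3,
    intervalIntegral.integral_neg, pK_int_sub h0 h1, pK_int_sub h0 h1, pK_int_sub h0 h1]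
  have e0 : pF ρ 0 = 0 := by simp [pF]
  have e1 : pF ρ (2 * Real.pi) = 0 := by simp [pF]
  have e2 : pF ρ (2 * Real.pi - t) = - pF ρ t := by
    simp only [pF, Real.sin_two_pi_sub, Real.cos_two_pi_sub]
    rw [mul_neg, neg_div, Real.arctan_neg]; ring
  rw [e0, e1, e2, ht, pF_arccos h0 h1]
  field_simp
  ring

lemma pK_abs_int_shift {ρ : ℝ} (h0 : 0 ≤ ρ) (h1 : ρ < 1) (φ : ℝ) :
    ∫ θ in (0:ℝ)..(2 * Real.pi), |pK ρ (φ - θ)| =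
      2 * Real.pi * (2 - (4 / Real.pi) * Real.arccos ρ) := by
  rw [← pK_abs_int h0 h1, intervalIntegral.integral_comp_sub_left (fun x => |pK ρ x|)]
  have hp : Function.Periodic (fun x => |pK ρ x|) (2 * Real.pi) := by
    intro x; simp only [pK_periodic ρ x]
  have := hp.intervalIntegral_add_eq (φ - 2 * Real.pi) 0
  simpa using this

lemma poisson_real {g : ℂ → ℂ} (hg : DifferentiableOn ℂ g (ball 0 1)) {r R : ℝ}
    (hr0 : 0 ≤ r) (hrR : r < R) (hR : R < 1) (θ : ℝ) :
    (g (r * Complex.exp (θ * Complex.I))).re - (g 0).re =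
    (1 / (2 * Real.pi)) * ∫ φ in (0:ℝ)..(2 * Real.pi),
      pK (r / R) (φ - θ) * (g (R * Complex.exp (φ * Complex.I))).re := by
  have hR0 : 0 < R := by linarith
  have hd : DiffContOnCl ℂ g (ball 0 R) := by
    apply DifferentiableOn.diffContOnCl
    apply hg.mono
    rw [closure_ball _ hR0.ne']
    exact closedBall_subset_ball hR
  set w : ℂ := r * Complex.exp (θ * Complex.I) with hw
  have hnw : ‖w‖ = r := by
    rw [hw, norm_mul, Complex.norm_exp_ofReal_mul_I]; simp [abs_of_nonneg hr0]
  have hcont : Continuous fun φ : ℝ => g (R * Complex.exp (φ * Complex.I)) := by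
    refine hg.continuousOn.comp_continuous (by fun_prop) ?_
    intro φ
    rw [mem_ball_zero_iff, norm_mul, Complex.norm_exp_ofReal_mul_I]
    simpa [abs_of_pos hR0] using hR
  have hcontre : Continuous fun φ : ℝ => (g (R * Complex.exp (φ * Complex.I))).re :=
    Complex.continuous_re.comp hcont
  have hρ0 : 0 ≤ r / R := by positivity
  have hρ1 : r / R < 1 := (div_lt_one hR0).2 hrR
  have key := hd.circleAverage_poissonKernel_smul' (w := w) (by simpa [hnw] using hrR)
  have key0 := hd.circleAverage_poissonKernel_smul' (w := 0) (by simpa using hR0)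
  have hker : ∀ φ : ℝ, (‖(R * Complex.exp (φ * Complex.I) : ℂ)‖ ^ 2 - ‖w‖ ^ 2) /
      ‖(R * Complex.exp (φ * Complex.I) : ℂ) - w‖ ^ 2 = pK (r / R) (φ - θ) + 1 := by
    intro φ
    have e : ‖(R * Complex.exp (φ * Complex.I) : ℂ) - w‖ ^ 2
        = R ^ 2 * (1 - 2 * (r / R) * Real.cos (φ - θ) + (r / R) ^ 2) := by
      rw [← Complex.normSq_eq_norm_sq, Complex.normSq_apply, hw]
      simp only [Complex.sub_re, Complex.sub_im, Complex.re_ofReal_mul, Complex.im_ofReal_mul,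
        Complex.exp_ofReal_mul_I_re, Complex.exp_ofReal_mul_I_im, Real.cos_sub]
      field_simp
      linear_combination R ^ 2 * Real.sin_sq_add_cos_sq φ + r ^ 2 * Real.sin_sq_add_cos_sq θ
    have hpos := (pK_den_pos hρ0 hρ1 (φ - θ)).ne'
    rw [e, hnw, norm_mul, Complex.norm_exp_ofReal_mul_I, pK]
    simp only [Complex.norm_real, Real.norm_eq_abs, mul_one, sq_abs]
    rw [sub_add_cancel, ← div_div]
    congr 1
    field_simp
  have hker0 : ∀ φ : ℝ, (‖(R * Complex.exp (φ * Complex.I) : ℂ)‖ ^ 2 - ‖(0:ℂ)‖ ^ 2) /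
      ‖(R * Complex.exp (φ * Complex.I) : ℂ) - 0‖ ^ 2 = 1 := by
    intro φ
    rw [norm_zero, sub_zero, norm_mul, Complex.norm_exp_ofReal_mul_I]
    simp only [Complex.norm_real, Real.norm_eq_abs, mul_one, sq_abs]
    field_simp
    simp
  simp only [Real.circleAverage, circleMap, zero_add, sub_zero] at key key0
  simp only [hker] at key
  simp only [sub_zero] at hker0
  simp only [hker0] at key0
  have hpkc : Continuous fun φ : ℝ => pK (r / R) (φ - θ) :=
    (pK_cont hρ0 hρ1).comp (by fun_prop)
  have k1 := congrArg Complex.re key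
  have k0 := congrArg Complex.re key0
  rw [Complex.smul_re] at k1 k0
  have s1 := Complex.reCLM.intervalIntegral_comp_comm (μ := volume) (a := 0) (b := 2 * Real.pi)
    (f := fun φ : ℝ => (pK (r / R) (φ - θ) + 1) • g (R * Complex.exp (φ * Complex.I)))
    (((hpkc.add continuous_const).smul hcont).intervalIntegrable _ _)
  have s0 := Complex.reCLM.intervalIntegral_comp_comm (μ := volume) (a := 0) (b := 2 * Real.pi)
    (f := fun φ : ℝ => (1:ℝ) • g (R * Complex.exp (φ * Complex.I)))
    ((hcont.const_smul (1:ℝ)).intervalIntegrable _ _)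
  simp only [Complex.reCLM_apply, Complex.smul_re, smul_eq_mul, one_mul] at s1 s0
  rw [← s1] at k1
  rw [← s0] at k0
  rw [← k1, ← k0, smul_eq_mul, smul_eq_mul, ← mul_sub, ← intervalIntegral.integral_sub]
  · rw [one_div]
    congr 1
    apply intervalIntegral.integral_congr
    intro φ _
    simp only
    ring
  · exact ((hpkc.add continuous_const).mul hcontre).intervalIntegrable _ _
  · exact hcontre.intervalIntegrable _ _

lemma step_bound {g : ℂ → ℂ} (hg : DifferentiableOn ℂ g (ball 0 1)) {r R : ℝ}
    (hr0 : 0 ≤ r) (hrR : r < R) (hR : R < 1) :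
    (1 / (2 * Real.pi)) * ∫ θ in (0:ℝ)..(2 * Real.pi),
      |(g (r * Complex.exp (θ * Complex.I))).re - (g 0).re| ≤
    ((1 / (2 * Real.pi)) * ∫ θ in (0:ℝ)..(2 * Real.pi),
      |(g (R * Complex.exp (θ * Complex.I))).re|) *
      (2 - (4 / Real.pi) * Real.arccos (r / R)) := by
  have hR0 : 0 < R := by linarith
  have hpi := Real.pi_pos
  have hρ0 : 0 ≤ r / R := by positivity
  have hρ1 : r / R < 1 := (div_lt_one hR0).2 hrR
  have hc : ∀ s : ℝ, 0 ≤ s → s < 1 →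
      Continuous fun φ : ℝ => (g (s * Complex.exp (φ * Complex.I))).re := by
    intro s hs0 hs1
    refine Complex.continuous_re.comp (hg.continuousOn.comp_continuous (by fun_prop) ?_)
    intro φ
    rw [mem_ball_zero_iff, norm_mul, Complex.norm_exp_ofReal_mul_I]
    simpa [abs_of_nonneg hs0] using hs1
  have hcr := hc r hr0 (by linarith)
  have hcR := hc R hR0.le hR
  set v : ℝ → ℝ := fun φ => (g (R * Complex.exp (φ * Complex.I))).re with hv
  have hpk := pK_cont hρ0 hρ1
  have hG : Continuous (Function.uncurry fun θ φ : ℝ => |pK (r / R) (φ - θ)| * |v φ|) := by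
    have h1 : Continuous fun p : ℝ × ℝ => pK (r / R) (p.2 - p.1) := hpk.comp (by fun_prop)
    have h2 : Continuous fun p : ℝ × ℝ => v p.2 := hcR.comp continuous_snd
    exact h1.abs.mul h2.abs
  have swap : ∫ θ in (0:ℝ)..(2 * Real.pi), ∫ φ in (0:ℝ)..(2 * Real.pi),
        |pK (r / R) (φ - θ)| * |v φ|
      = ∫ φ in (0:ℝ)..(2 * Real.pi), ∫ θ in (0:ℝ)..(2 * Real.pi),
        |pK (r / R) (φ - θ)| * |v φ| := by
    apply intervalIntegral_intervalIntegral_swap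
    refine (hG.continuousOn.integrableOn_compact
      ((isCompact_uIcc (a := (0:ℝ)) (b := 2 * Real.pi)).prod
        (isCompact_uIcc (a := (0:ℝ)) (b := 2 * Real.pi)))).mono_set ?_
    exact Set.prod_mono Set.uIoc_subset_uIcc Set.uIoc_subset_uIcc
  have hpt : ∀ θ : ℝ, |(g (r * Complex.exp (θ * Complex.I))).re - (g 0).re| ≤
      (1 / (2 * Real.pi)) * ∫ φ in (0:ℝ)..(2 * Real.pi), |pK (r / R) (φ - θ)| * |v φ| := by
    intro θ
    rw [poisson_real hg hr0 hrR hR θ, abs_mul, abs_of_pos (by positivity : 0 < 1 / (2 * Real.pi))]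
    gcongr
    refine (intervalIntegral.abs_integral_le_integral_abs (by positivity)).trans_eq ?_
    simp only [abs_mul, hv]
  have hmono : ∫ θ in (0:ℝ)..(2 * Real.pi),
      |(g (r * Complex.exp (θ * Complex.I))).re - (g 0).re| ≤
      ∫ θ in (0:ℝ)..(2 * Real.pi), (1 / (2 * Real.pi)) * ∫ φ in (0:ℝ)..(2 * Real.pi),
        |pK (r / R) (φ - θ)| * |v φ| := by
    apply intervalIntegral.integral_mono (by positivity)
    · exact (hcr.sub continuous_const).abs.intervalIntegrable _ _
    · apply Continuous.intervalIntegrable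
      exact continuous_const.mul
        (intervalIntegral.continuous_parametric_intervalIntegral_of_continuous' hG _ _)
    · exact hpt
  rw [intervalIntegral.integral_const_mul, swap] at hmono
  simp only [intervalIntegral.integral_mul_const, pK_abs_int_shift hρ0 hρ1,
    intervalIntegral.integral_const_mul] at hmono
  calc _ ≤ (1 / (2 * Real.pi)) * (1 / (2 * Real.pi) *
      (2 * Real.pi * (2 - 4 / Real.pi * Real.arccos (r / R)) *
        ∫ x in (0:ℝ)..(2 * Real.pi), |v x|)) := by gcongr
    _ = _ := by
      simp only [hv]
      generalize (∫ x in (0:ℝ)..(2 * Real.pi), |(g (R * Complex.exp (x * Complex.I))).re|) = J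
      field_simp

theorem stmt_16 (u : ℂ → ℝ)
    (hharm : ∃ g : ℂ → ℂ, DifferentiableOn ℂ g (ball 0 1) ∧
      ∀ z ∈ ball (0:ℂ) 1, u z = (g z).re)
    (hbdd : BddAbove {y : ℝ | ∃ s : ℝ, 0 ≤ s ∧ s < 1 ∧
      y = (1 / (2 * Real.pi)) * ∫ θ in (0:ℝ)..(2 * Real.pi),
        |u (s * Complex.exp (θ * Complex.I))|})
    (r : ℝ) (hr0 : 0 ≤ r) (hr1 : r < 1) :
    (1 / (2 * Real.pi)) * ∫ θ in (0:ℝ)..(2 * Real.pi),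
        |u (r * Complex.exp (θ * Complex.I)) - u 0| ≤
      sSup {y : ℝ | ∃ s : ℝ, 0 ≤ s ∧ s < 1 ∧
        y = (1 / (2 * Real.pi)) * ∫ θ in (0:ℝ)..(2 * Real.pi),
          |u (s * Complex.exp (θ * Complex.I))|} *
      (2 - (4 / Real.pi) * Real.arccos r) := by
  obtain ⟨g, hg, hu⟩ := hharm
  have hcirc : ∀ s θ : ℝ, 0 ≤ s → s < 1 → u (s * Complex.exp (θ * Complex.I)) =
      (g (s * Complex.exp (θ * Complex.I))).re := by
    intro s θ hs0 hs1
    apply hu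
    rw [mem_ball_zero_iff, norm_mul, Complex.norm_exp_ofReal_mul_I]
    simpa [abs_of_nonneg hs0] using hs1
  set M := sSup {y : ℝ | ∃ s : ℝ, 0 ≤ s ∧ s < 1 ∧
      y = (1 / (2 * Real.pi)) * ∫ θ in (0:ℝ)..(2 * Real.pi),
        |u (s * Complex.exp (θ * Complex.I))|} with hM
  have hpi := Real.pi_pos
  have hstep : ∀ R : ℝ, r < R → R < 1 →
      (1 / (2 * Real.pi)) * ∫ θ in (0:ℝ)..(2 * Real.pi),
        |u (r * Complex.exp (θ * Complex.I)) - u 0| ≤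
      M * (2 - (4 / Real.pi) * Real.arccos (r / R)) := by
    intro R hrR hR
    have h := step_bound hg hr0 hrR hR
    simp only [← hcirc r _ hr0 hr1, ← hcirc R _ (hr0.trans hrR.le) hR,
      ← hu 0 (by simp)] at h
    refine h.trans ?_
    apply mul_le_mul_of_nonneg_right
    · exact le_csSup hbdd ⟨R, hr0.trans hrR.le, hR, rfl⟩
    · have : Real.arccos (r / R) ≤ Real.pi / 2 :=
        Real.arccos_le_pi_div_two.2 (div_nonneg hr0 (hr0.trans hrR.le))
      have h4 : 4 / Real.pi * Real.arccos (r / R) ≤ 4 / Real.pi * (Real.pi / 2) := by gcongr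
      have h5 : 4 / Real.pi * (Real.pi / 2) = 2 := by field_simp; norm_num
      linarith
  have hlim : Filter.Tendsto (fun R : ℝ => M * (2 - (4 / Real.pi) * Real.arccos (r / R)))
      (nhdsWithin 1 (Set.Iio 1)) (nhds (M * (2 - (4 / Real.pi) * Real.arccos r))) := by
    have hca : ContinuousAt (fun R : ℝ => M * (2 - (4 / Real.pi) * Real.arccos (r / R))) 1 := by
      have h1 : ContinuousAt (fun R : ℝ => r / R) 1 :=
        continuousAt_const.div continuousAt_id one_ne_zero
      have h2 : ContinuousAt (fun R : ℝ => Real.arccos (r / R)) 1 :=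
        Real.continuous_arccos.continuousAt.comp h1
      exact continuousAt_const.mul (continuousAt_const.sub (continuousAt_const.mul h2))
    have := hca.tendsto.mono_left (nhdsWithin_le_nhds (s := Set.Iio 1))
    simpa using this
  refine ge_of_tendsto hlim ?_
  filter_upwards [Ioo_mem_nhdsLT hr1] with R hR
  exact hstep R hR.1 hR.2
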